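/- Let X and Y be complex Banach spaces and let f : X → Y be holomorphic on B_X, 1-Lipschitz on B_X, with f(0) = 0. Then there exists a sequence (g_m) of functions X → Y, where each g_m is a continuous polynomial vanishing at 0 (that is, g_m(x) = Σ_{k=1}^{N_m} M_{m,k}(x, …, x) for some continuous k-linear maps M_{m,k} : X^k → Y), such that each g_m is 1-Lipschitz on B_X and g_m(x) → f(x) for every x ∈ B_X. -/

import Mathlib

/-- A continuous polynomial vanishing at `0`: a finite sum of terms `x ↦ M k (x, …, x)`
where each `M k` is a continuous `(k+1)`-linear map (so every term has degree `≥ 1`). -/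
def IsContPolyVanishingAtZero {X Y : Type*} [NormedAddCommGroup X] [NormedSpace ℂ X]
    [NormedAddCommGroup Y] [NormedSpace ℂ Y] (g : X → Y) : Prop :=
  ∃ N : ℕ, ∃ M : ∀ k : Fin N, ContinuousMultilinearMap ℂ (fun _ : Fin (k + 1) => X) Y,
    ∀ x : X, g x = ∑ k : Fin N, M k (fun _ => x)

section Holomorphic

open Metric Set Filter Topology

variable {E F : Type*} [NormedAddCommGroup E] [NormedSpace ℂ E]
  [NormedAddCommGroup F] [NormedSpace ℂ F]

/-- **Cauchy's estimate** for the Fréchet derivative. -/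
theorem norm_fderiv_le_div_of_norm_le_on_ball {f : E → F} {x : E} {r C : ℝ} (hr : 0 < r)
    (hf : DifferentiableOn ℂ f (ball x r)) (hC : ∀ y ∈ ball x r, ‖f y‖ ≤ C) :
    ‖fderiv ℂ f x‖ ≤ C / r := by
  have hC0 : 0 ≤ C := (norm_nonneg _).trans (hC x (mem_ball_self hr))
  have hfx : DifferentiableAt ℂ f x := hf.differentiableAt (ball_mem_nhds x hr)
  refine ContinuousLinearMap.opNorm_le_bound _ (by positivity) fun v => ?_
  rcases eq_or_ne v 0 with rfl | hv
  · simp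
  have hv0 : 0 < ‖v‖ := norm_pos_iff.2 hv
  have hmem : ∀ z : ℂ, ∀ s < r, ‖z‖ * ‖v‖ ≤ s → x + z • v ∈ ball x r := fun z s hs hz => by
    simpa [norm_smul] using hz.trans_lt hs
  have hsmall : ∀ s ∈ Ioo 0 r, ‖fderiv ℂ f x v‖ * s ≤ C * ‖v‖ := by
    intro s hs
    have hs0 : 0 < s := hs.1
    have hderiv : _root_.deriv (fun z : ℂ => f (x + z • v)) 0 = fderiv ℂ f x v := by
      have : DifferentiableAt ℂ f (x + (0 : ℂ) • v) := by simpa using hfx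
      simpa using this.deriv_comp_add_smul
    have hdiff : DifferentiableOn ℂ (fun z : ℂ => f (x + z • v)) (closedBall 0 (s / ‖v‖)) := by
      refine hf.comp (by fun_prop) fun z hz => hmem z s hs.2 ?_
      simpa [le_div_iff₀ hv0] using hz
    have key := Complex.norm_deriv_le_of_forall_mem_sphere_norm_le (C := C) (by positivity)
      (hdiff.mono closure_ball_subset_closedBall).diffContOnCl fun z hz => hC _ (hmem z s hs.2 (by
        simpa [le_div_iff₀ hv0] using (mem_sphere.1 hz).le))
    rw [hderiv, div_div_eq_mul_div, le_div_iff₀ hs0] at key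
    exact key
  have hlim : Tendsto (fun s => ‖fderiv ℂ f x v‖ * s) (𝓝[<] r) (𝓝 (‖fderiv ℂ f x v‖ * r)) :=
    ((continuous_const.mul continuous_id).tendsto r).mono_left nhdsWithin_le_nhds
  have := le_of_tendsto hlim (eventually_of_mem (Ioo_mem_nhdsLT hr) hsmall)
  rw [div_mul_eq_mul_div, le_div_iff₀ hr]
  exact this

/-- Cauchy's estimate on a concentric smaller ball. -/
theorem norm_fderiv_le_div_of_mem_ball {f : E → F} {x y : E} {r C : ℝ} (hr : 0 < r)
    (hf : DifferentiableOn ℂ f (ball x (3 * r))) (hC : ∀ y ∈ ball x (3 * r), ‖f y‖ ≤ C)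
    (hy : y ∈ ball x (2 * r)) : ‖fderiv ℂ f y‖ ≤ C / r := by
  have hsub : ball y r ⊆ ball x (3 * r) := ball_subset_ball' (by
    rw [mem_ball] at hy; linarith)
  exact norm_fderiv_le_div_of_norm_le_on_ball hr (hf.mono hsub) fun z hz => hC z (hsub hz)

/-- The Fréchet derivative of a bounded holomorphic function is Lipschitz at the center of the
ball, with an explicit constant. -/
theorem norm_fderiv_sub_fderiv_center_le {f : E → F} {x y : E} {r C : ℝ} (hr : 0 < r)
    (hf : DifferentiableOn ℂ f (ball x (3 * r))) (hC : ∀ y ∈ ball x (3 * r), ‖f y‖ ≤ C)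
    (hy : y ∈ ball x r) : ‖fderiv ℂ f y - fderiv ℂ f x‖ ≤ C / r / r * ‖y - x‖ := by
  have hdiff : ∀ z ∈ ball x (2 * r), DifferentiableAt ℂ f z := fun z hz =>
    hf.differentiableAt (isOpen_ball.mem_nhds (ball_subset_ball (by linarith) hz))
  have hsub : ball x r ⊆ ball x (2 * r) := ball_subset_ball (by linarith)
  have hshift : ∀ z ∈ ball x r, z + (y - x) ∈ ball x (2 * r) := fun z hz => by
    rw [mem_ball, dist_eq_norm] at *
    calc ‖z + (y - x) - x‖ = ‖(z - x) + (y - x)‖ := by congr 1; abel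
      _ ≤ ‖z - x‖ + ‖y - x‖ := norm_add_le _ _
      _ < 2 * r := by linarith
  have hshiftdiff : ∀ z ∈ ball x r, DifferentiableAt ℂ (fun z => f (z + (y - x))) z :=
    fun z hz => (hdiff _ (hshift z hz)).comp z (by fun_prop : DifferentiableAt ℂ (· + (y - x)) z)
  have hx : x ∈ ball x r := mem_ball_self hr
  have key := norm_fderiv_le_div_of_norm_le_on_ball (f := fun z => f (z + (y - x)) - f z)
    (x := x) (C := C / r * ‖y - x‖) hr
    (fun z hz => ((hshiftdiff z hz).sub (hdiff z (hsub hz))).differentiableWithinAt)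
    fun z hz => by
      have := (convex_ball x (2 * r)).norm_image_sub_le_of_norm_fderiv_le hdiff
        (fun w hw => norm_fderiv_le_div_of_mem_ball hr hf hC hw) (hsub hz) (hshift z hz)
      simpa using this
  rw [fderiv_fun_sub (hshiftdiff x hx) (hdiff x (hsub hx)), fderiv_comp_add_right,
    add_sub_cancel] at key
  exact key.trans_eq (by ring)

theorem exists_ball_subset_norm_le {f : E → F} {U : Set E} (hU : IsOpen U)
    (hf : DifferentiableOn ℂ f U) {x : E} (hx : x ∈ U) :
    ∃ r > 0, ∃ C, ball x (3 * r) ⊆ U ∧ ∀ y ∈ ball x (3 * r), ‖f y‖ ≤ C := by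
  have hcont : ContinuousAt f x := (hf.differentiableAt (hU.mem_nhds hx)).continuousAt
  have hbdd : ∀ᶠ y in 𝓝 x, ‖f y‖ < ‖f x‖ + 1 :=
    hcont.norm.eventually_lt continuousAt_const (by simp)
  obtain ⟨R, hR, h⟩ := Metric.mem_nhds_iff.1 (inter_mem (hU.mem_nhds hx) hbdd)
  exact ⟨R / 3, by positivity, ‖f x‖ + 1,
    fun y hy => (h (by rwa [mul_div_cancel₀ R three_ne_zero] at hy)).1,
    fun y hy => le_of_lt (h (by rwa [mul_div_cancel₀ R three_ne_zero] at hy)).2⟩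

theorem DifferentiableOn.continuousOn_fderiv_complex {f : E → F} {U : Set E} (hU : IsOpen U)
    (hf : DifferentiableOn ℂ f U) : ContinuousOn (fderiv ℂ f) U := by
  intro x hx
  obtain ⟨r, hr, C, hsub, hC⟩ := exists_ball_subset_norm_le hU hf hx
  refine ContinuousAt.continuousWithinAt ?_
  refine continuousAt_of_locally_lipschitz hr (C / r / r) fun y hy => ?_
  rw [dist_eq_norm, dist_eq_norm]
  exact norm_fderiv_sub_fderiv_center_le hr (hf.mono hsub) hC hy

/-- Directional derivatives of a holomorphic function are holomorphic. -/
theorem DifferentiableOn.fderiv_apply_const_complex [CompleteSpace F] {f : E → F} {U : Set E}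
    (hU : IsOpen U) (hf : DifferentiableOn ℂ f U) (v : E) :
    DifferentiableOn ℂ (fun x => fderiv ℂ f x v) U := by
  intro x hx
  obtain ⟨r, hr, C, hsub, hC⟩ := exists_ball_subset_norm_le hU hf hx
  obtain ⟨ρ, hρ, hρv⟩ : ∃ ρ > 0, ρ * ‖v‖ < r := by
    refine ⟨r / (‖v‖ + 1), by positivity, ?_⟩
    rw [div_mul_eq_mul_div, div_lt_iff₀ (by positivity)]
    nlinarith [norm_nonneg v]
  have hmem : ∀ y ∈ ball x r, ∀ z : ℂ, ‖z‖ ≤ ρ → y + z • v ∈ ball x (2 * r) := by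
    intro y hy z hz
    rw [mem_ball, dist_eq_norm] at *
    calc ‖y + z • v - x‖ = ‖(y - x) + z • v‖ := by congr 1; abel
      _ ≤ ‖y - x‖ + ‖z‖ * ‖v‖ := (norm_add_le _ _).trans_eq (by rw [norm_smul])
      _ < 2 * r := by nlinarith [norm_nonneg v]
  have hdiff : ∀ y ∈ ball x (2 * r), DifferentiableAt ℂ f y := fun y hy =>
    hf.differentiableAt (hU.mem_nhds (hsub (ball_subset_ball (by linarith) hy)))
  have hcirc : ∀ θ : ℝ, ‖circleMap 0 ρ θ‖ ≤ ρ := fun θ => by simp [abs_of_pos hρ]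
  have hformula : ∀ y ∈ ball x r, fderiv ℂ f y v =
      (2 * Real.pi * Complex.I)⁻¹ • ∫ θ in Ioc 0 (2 * Real.pi),
        (_root_.deriv (circleMap 0 ρ) θ * (1 / circleMap 0 ρ θ ^ 2)) • f (y + circleMap 0 ρ θ • v) := by
    intro y hy
    have hd : DifferentiableOn ℂ (fun z : ℂ => f (y + z • v)) (closedBall 0 ρ) := fun z hz =>
      ((hdiff _ (hmem y hy z (by simpa using hz))).comp z
        (by fun_prop : DifferentiableAt ℂ (fun z : ℂ => y + z • v) z)).differentiableWithinAt
    have hderiv : _root_.deriv (fun z : ℂ => f (y + z • v)) 0 = fderiv ℂ f y v := by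
      have : DifferentiableAt ℂ f (y + (0 : ℂ) • v) := by
        simpa using hdiff y (ball_subset_ball (by linarith) hy)
      simpa using this.deriv_comp_add_smul
    have := hd.deriv_eq_smul_circleIntegral hρ
    rw [hderiv] at this
    rw [eq_inv_smul_iff₀ Complex.two_pi_I_ne_zero, ← this, circleIntegral,
      intervalIntegral.integral_of_le Real.two_pi_pos.le]
    simp [smul_smul]
  have hcoef : Continuous fun θ => _root_.deriv (circleMap 0 ρ) θ * (1 / circleMap 0 ρ θ ^ 2) := by
    simp only [deriv_circleMap, one_div]
    have := (continuous_circleMap 0 ρ)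
    exact (this.mul continuous_const).mul ((this.pow 2).inv₀ fun θ =>
      pow_ne_zero 2 (circleMap_ne_center hρ.ne'))
  have hcoefnorm : ∀ θ, ‖_root_.deriv (circleMap 0 ρ) θ * (1 / circleMap 0 ρ θ ^ 2)‖ = ρ⁻¹ := by
    intro θ
    simp only [deriv_circleMap, one_div, norm_mul, norm_inv, norm_pow, Complex.norm_I,
      norm_circleMap_zero, abs_of_pos hρ]
    field_simp
  have hFcont : ∀ y ∈ ball x r, Continuous fun θ => (_root_.deriv (circleMap 0 ρ) θ *
      (1 / circleMap 0 ρ θ ^ 2)) • f (y + circleMap 0 ρ θ • v) := fun y hy => by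
    refine hcoef.smul (continuous_iff_continuousAt.2 fun θ => ?_)
    exact ContinuousAt.comp (f := fun θ => y + circleMap 0 ρ θ • v)
      (hdiff _ (hmem y hy _ (hcirc θ))).continuousAt (by fun_prop)
  have hF'cont : Continuous fun θ => (_root_.deriv (circleMap 0 ρ) θ *
      (1 / circleMap 0 ρ θ ^ 2)) • fderiv ℂ f (x + circleMap 0 ρ θ • v) := by
    refine hcoef.smul (continuous_iff_continuousAt.2 fun θ => ?_)
    have hz := hmem x (mem_ball_self hr) _ (hcirc θ)
    exact ContinuousAt.comp (f := fun θ => x + circleMap 0 ρ θ • v)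
      ((hf.continuousOn_fderiv_complex hU).continuousAt
        (hU.mem_nhds (hsub (ball_subset_ball (by linarith) hz)))) (by fun_prop)
  have hderivInt := hasFDerivAt_integral_of_dominated_of_fderiv_le
    (μ := MeasureTheory.volume.restrict (Ioc 0 (2 * Real.pi))) (𝕜 := ℂ)
    (F := fun y θ => (_root_.deriv (circleMap 0 ρ) θ *
      (1 / circleMap 0 ρ θ ^ 2)) • f (y + circleMap 0 ρ θ • v))
    (F' := fun y θ => (_root_.deriv (circleMap 0 ρ) θ *
      (1 / circleMap 0 ρ θ ^ 2)) • fderiv ℂ f (y + circleMap 0 ρ θ • v))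
    (bound := fun _ => ρ⁻¹ * (C / r)) (ball_mem_nhds x hr)
    (eventually_of_mem (ball_mem_nhds x hr) fun y hy => (hFcont y hy).aestronglyMeasurable)
    ((hFcont x (mem_ball_self hr)).integrableOn_Ioc) hF'cont.aestronglyMeasurable
    (Eventually.of_forall fun θ y hy => by
      rw [norm_smul, hcoefnorm]
      gcongr
      exact norm_fderiv_le_div_of_mem_ball hr (hf.mono hsub) hC (hmem y hy _ (hcirc θ)))
    (MeasureTheory.integrable_const _)
    (Eventually.of_forall fun θ y hy => by
      refine HasFDerivAt.const_smul ?_ _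
      exact (hasFDerivAt_comp_add_right _).2 (hdiff _ (hmem y hy _ (hcirc θ))).hasFDerivAt)
  refine DifferentiableAt.differentiableWithinAt ?_
  refine (hderivInt.differentiableAt.const_smul (2 * Real.pi * Complex.I)⁻¹).congr_of_eventuallyEq ?_
  exact eventually_of_mem (ball_mem_nhds x hr) hformula

/-- The Fréchet derivative of a holomorphic function between complex Banach spaces is
holomorphic. -/
theorem DifferentiableOn.fderiv_complex [CompleteSpace F] {f : E → F} {U : Set E}
    (hU : IsOpen U) (hf : DifferentiableOn ℂ f U) : DifferentiableOn ℂ (fderiv ℂ f) U := by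
  intro x hx
  obtain ⟨r, hr, C, hsub, hC⟩ := exists_ball_subset_norm_le hU hf hx
  have hC0 : 0 ≤ C := (norm_nonneg _).trans (hC x (mem_ball_self (by positivity)))
  obtain ⟨s, hs, rfl⟩ : ∃ s > 0, r = 2 * s := ⟨r / 2, by positivity, by ring⟩
  set K := C / (2 * s)
  have hdir : ∀ h, DifferentiableOn ℂ (fun y => fderiv ℂ f y h) (ball x (3 * s)) := fun h =>
    (hf.fderiv_apply_const_complex hU h).mono
      ((ball_subset_ball (by linarith)).trans hsub)
  have hdirC : ∀ h, ∀ y ∈ ball x (3 * s), ‖fderiv ℂ f y h‖ ≤ K * ‖h‖ := fun h y hy =>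
    ((fderiv ℂ f y).le_opNorm h).trans (by
      gcongr
      exact norm_fderiv_le_div_of_mem_ball hr (hf.mono hsub) hC
        (ball_subset_ball (by linarith) hy))
  have hdirAt : ∀ h, ∀ y ∈ ball x s, DifferentiableAt ℂ (fun y => fderiv ℂ f y h) y :=
    fun h y hy => (hdir h).differentiableAt
      (isOpen_ball.mem_nhds (ball_subset_ball (by linarith) hy))
  have hxs : x ∈ ball x s := mem_ball_self hs
  let T : E →L[ℂ] E →L[ℂ] F := LinearMap.mkContinuous₂
    (LinearMap.mk₂ ℂ (fun v h => fderiv ℂ (fun y => fderiv ℂ f y h) x v)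
      (fun _ _ _ => by simp) (fun _ _ _ => by simp)
      (fun v h h' => by
        simp only [map_add]
        rw [fderiv_fun_add (hdirAt h x hxs) (hdirAt h' x hxs)]; rfl)
      (fun c v h => by
        simp only [map_smul]
        rw [fderiv_fun_const_smul (hdirAt h x hxs)]; rfl))
    (K / s) fun v h => by
      refine ((fderiv ℂ (fun y => fderiv ℂ f y h) x).le_opNorm v).trans ?_
      have := norm_fderiv_le_div_of_mem_ball hs (hdir h) (hdirC h) (y := x)
        (mem_ball_self (by positivity))
      calc _ ≤ K * ‖h‖ / s * ‖v‖ := by gcongr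
        _ = _ := by ring
  have hT : ∀ v h, T v h = fderiv ℂ (fun y => fderiv ℂ f y h) x v := fun _ _ => rfl
  refine HasFDerivAt.differentiableAt (f' := T) ?_ |>.differentiableWithinAt
  rw [hasFDerivAt_iff_isLittleO_nhds_zero]
  refine Asymptotics.IsBigO.trans_isLittleO (g := fun v : E => ‖v‖ ^ 2) ?_ ?_
  · refine Asymptotics.IsBigO.of_bound (K / s / s) ?_
    filter_upwards [ball_mem_nhds (0 : E) hs] with v hv
    have hv : ‖v‖ < s := by simpa using hv
    refine ContinuousLinearMap.opNorm_le_bound _ (by positivity) fun h => ?_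
    have hle : closedBall x ‖v‖ ⊆ ball x s := closedBall_subset_ball hv
    have := (convex_closedBall x ‖v‖).norm_image_sub_le_of_norm_fderiv_le'
      (f := fun y => fderiv ℂ f y h) (φ := fderiv ℂ (fun y => fderiv ℂ f y h) x)
      (C := K * ‖h‖ / s / s * ‖v‖) (x := x) (y := x + v)
      (fun y hy => hdirAt h y (hle hy))
      (fun y hy => (norm_fderiv_sub_fderiv_center_le hs (hdir h) (hdirC h) (hle hy)).trans (by
        gcongr
        simpa [dist_eq_norm] using hy)) (mem_closedBall_self (norm_nonneg v)) (by simp)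
    rw [add_sub_cancel_left] at this
    simp only [sub_apply, hT]
    refine this.trans_eq ?_
    simp only [norm_pow, norm_norm]
    ring
  · exact Asymptotics.isLittleO_norm_pow_id one_lt_two

theorem DifferentiableOn.iteratedFDeriv_complex [CompleteSpace F] {f : E → F} {U : Set E}
    (hU : IsOpen U) (hf : DifferentiableOn ℂ f U) (n : ℕ) :
    DifferentiableOn ℂ (iteratedFDeriv ℂ n f) U := by
  induction n with
  | zero =>
    rw [iteratedFDeriv_zero_eq_comp]
    exact (continuousMultilinearCurryFin0 ℂ E F).symm.differentiable.comp_differentiableOn hf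
  | succ n ih =>
    rw [iteratedFDeriv_succ_eq_comp_left]
    have hcurry := (continuousMultilinearCurryLeftEquiv ℂ
      (fun _ : Fin (n + 1) ↦ E) F).symm.toContinuousLinearEquiv.toContinuousLinearMap.differentiable
    exact hcurry.comp_differentiableOn (ih.fderiv_complex hU)

/-- Along the line through `x`, the iterated derivatives of a holomorphic function are the
diagonal values of its iterated Fréchet derivatives. -/
theorem iteratedDeriv_comp_smul_right [CompleteSpace F] {f : E → F} {U : Set E}
    (hU : IsOpen U) (hf : DifferentiableOn ℂ f U) (x : E) (n : ℕ) {z : ℂ} (hz : z • x ∈ U) :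
    iteratedDeriv n (fun z : ℂ => f (z • x)) z = iteratedFDeriv ℂ n f (z • x) fun _ => x := by
  induction n generalizing z with
  | zero => simp
  | succ n ih =>
    have hd : DifferentiableAt ℂ (iteratedFDeriv ℂ n f) (z • x) :=
      (hf.iteratedFDeriv_complex hU n).differentiableAt (hU.mem_nhds hz)
    have hev : iteratedDeriv n (fun z : ℂ => f (z • x)) =ᶠ[𝓝 z]
        fun w => iteratedFDeriv ℂ n f (w • x) fun _ => x :=
      eventually_of_mem ((hU.preimage (by fun_prop : Continuous fun w : ℂ => w • x)).mem_nhds hz)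
        fun w hw => ih hw
    rw [iteratedDeriv_succ, hev.deriv_eq, hd.iteratedFDeriv_succ_apply_left']
    have := ((hd.continuousMultilinear_apply_const fun _ => x).hasFDerivAt.comp_hasDerivAt z
      ((hasDerivAt_id z).smul_const x)).deriv
    rw [one_smul] at this
    exact this

end Holomorphic

section Cesaro

open Metric Set MeasureTheory Complex

variable {F : Type*} [NormedAddCommGroup F] [NormedSpace ℂ F]

/-- The `k`-th Taylor coefficient at `0`. -/
noncomputable def taylorCoeffZero (h : ℂ → F) (k : ℕ) : F :=
  ((k.factorial : ℂ)⁻¹) • iteratedDeriv k h 0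

variable {h : ℂ → F}

theorem continuous_comp_circleMap_of_differentiableOn
    (hh : DifferentiableOn ℂ h (closedBall 0 1)) :
    Continuous fun θ => h (circleMap 0 1 θ) :=
  hh.continuousOn.comp_continuous (continuous_circleMap 0 1)
    fun θ => circleMap_mem_closedBall 0 zero_le_one θ

/-- Nonnegative Fourier coefficients of the boundary values are Taylor coefficients. -/
theorem integral_circleMap_inv_pow_smul [CompleteSpace F]
    (hh : DifferentiableOn ℂ h (closedBall 0 1)) (k : ℕ) :
    ∫ θ in 0..2 * Real.pi, ((circleMap 0 1 θ)⁻¹ ^ k) • h (circleMap 0 1 θ) =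
      (2 * Real.pi : ℂ) • taylorCoeffZero h k := by
  have := hh.circleIntegral_one_div_sub_center_pow_smul zero_lt_one k
  have hI : ∮ z in C(0, 1), (1 / (z - 0) ^ (k + 1)) • h z =
      I • ∫ θ in 0..2 * Real.pi, ((circleMap 0 1 θ)⁻¹ ^ k) • h (circleMap 0 1 θ) := by
    rw [circleIntegral, ← intervalIntegral.integral_smul]
    refine intervalIntegral.integral_congr fun θ _ => ?_
    have hne : circleMap 0 1 θ ≠ 0 := circleMap_ne_center one_ne_zero
    simp only [deriv_circleMap, smul_smul, sub_zero]
    congr 1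
    rw [inv_pow]
    field_simp
    ring
  rw [hI] at this
  refine smul_right_injective F I_ne_zero ?_
  simp only [this, taylorCoeffZero, smul_smul]
  congr 1
  ring

/-- Negative Fourier coefficients of the boundary values vanish. -/
theorem integral_circleMap_pow_succ_smul (hh : DifferentiableOn ℂ h (closedBall 0 1)) (k : ℕ) :
    ∫ θ in 0..2 * Real.pi, (circleMap 0 1 θ ^ (k + 1)) • h (circleMap 0 1 θ) = 0 := by
  have hd : DifferentiableOn ℂ (fun z : ℂ => z ^ k • h z) (closedBall 0 1) :=
    (by fun_prop : DifferentiableOn ℂ (fun z : ℂ => z ^ k) (closedBall 0 1)).smul hh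
  have := (hd.mono closure_ball_subset_closedBall).diffContOnCl.circleIntegral_eq_zero
    zero_le_one
  have hI : ∮ z in C(0, 1), z ^ k • h z =
      I • ∫ θ in 0..2 * Real.pi, (circleMap 0 1 θ ^ (k + 1)) • h (circleMap 0 1 θ) := by
    rw [circleIntegral, ← intervalIntegral.integral_smul]
    refine intervalIntegral.integral_congr fun θ _ => ?_
    simp only [deriv_circleMap, smul_smul]
    congr 1
    ring
  rw [hI] at this
  exact (smul_eq_zero.1 this).resolve_left I_ne_zero

theorem fejer_kernel_eq_sum (m : ℕ) (θ : ℝ) :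
    ((‖∑ j ∈ Finset.range m, circleMap 0 1 θ ^ j‖ ^ 2 : ℝ) : ℂ) =
      ∑ l ∈ Finset.range m, ∑ j ∈ Finset.range m,
        circleMap 0 1 θ ^ j * (circleMap 0 1 θ)⁻¹ ^ l := by
  have hconj : (starRingEnd ℂ) (circleMap 0 1 θ) = (circleMap 0 1 θ)⁻¹ := by
    rw [inv_def, normSq_eq_norm_sq]; simp
  rw [ofReal_pow, ← mul_conj', map_sum, Finset.sum_mul_sum, Finset.sum_comm]
  simp [hconj]

theorem integral_circleMap_pow_mul_inv_pow_smul [CompleteSpace F]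
    (hh : DifferentiableOn ℂ h (closedBall 0 1)) (j l : ℕ) :
    ∫ θ in 0..2 * Real.pi,
        (circleMap 0 1 θ ^ j * (circleMap 0 1 θ)⁻¹ ^ l) • h (circleMap 0 1 θ) =
      if j ≤ l then (2 * Real.pi : ℂ) • taylorCoeffZero h (l - j) else 0 := by
  have hne : ∀ θ, circleMap 0 1 θ ≠ 0 := fun θ => circleMap_ne_center one_ne_zero
  split_ifs with hjl
  · obtain ⟨k, rfl⟩ := Nat.exists_eq_add_of_le hjl
    rw [Nat.add_sub_cancel_left, ← integral_circleMap_inv_pow_smul hh k]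
    refine intervalIntegral.integral_congr fun θ _ => ?_
    have := hne θ
    congr 1
    rw [pow_add, inv_pow, inv_pow]
    field_simp
  · obtain ⟨k, rfl⟩ := Nat.exists_eq_add_of_lt (not_le.1 hjl)
    rw [← integral_circleMap_pow_succ_smul hh k]
    refine intervalIntegral.integral_congr fun θ _ => ?_
    have := hne θ
    congr 1
    rw [add_assoc, pow_add, inv_pow]
    field_simp

/-- **Fejér's formula**: the sum of the first `m` partial sums of the Taylor series at the point
`1` is an integral of the boundary values against a nonnegative kernel. -/
theorem integral_fejer_kernel_smul [CompleteSpace F]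
    (hh : DifferentiableOn ℂ h (closedBall 0 1)) (m : ℕ) :
    ∫ θ in 0..2 * Real.pi,
        ((‖∑ j ∈ Finset.range m, circleMap 0 1 θ ^ j‖ ^ 2 : ℝ) : ℂ) • h (circleMap 0 1 θ) =
      (2 * Real.pi : ℂ) •
        ∑ l ∈ Finset.range m, ∑ k ∈ Finset.range (l + 1), taylorCoeffZero h k := by
  have hcont := continuous_comp_circleMap_of_differentiableOn hh
  have hterm : ∀ j l : ℕ, Continuous fun θ =>
      (circleMap 0 1 θ ^ j * (circleMap 0 1 θ)⁻¹ ^ l) • h (circleMap 0 1 θ) := fun j l => by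
    have hc := continuous_circleMap 0 1
    exact ((hc.pow j).mul ((hc.inv₀ fun θ => circleMap_ne_center one_ne_zero).pow l)).smul hcont
  simp only [fejer_kernel_eq_sum, Finset.sum_smul]
  rw [intervalIntegral.integral_finsetSum fun l _ =>
    (continuous_finsetSum _ fun j _ => hterm j l).intervalIntegrable _ _]
  rw [Finset.smul_sum]
  refine Finset.sum_congr rfl fun l hl => ?_
  rw [intervalIntegral.integral_finsetSum fun j _ => (hterm j l).intervalIntegrable _ _]
  simp only [integral_circleMap_pow_mul_inv_pow_smul hh]
  rw [← Finset.sum_filter, ← Finset.smul_sum, ← Finset.sum_range_reflect]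
  congr 1
  refine Finset.sum_congr ?_ fun j _ => by rw [Nat.add_sub_cancel]
  ext j
  have := Finset.mem_range.1 hl
  simp only [Finset.mem_filter, Finset.mem_range]
  omega

/-- The Cesàro means of the Taylor series at the point `1` are bounded by the supremum of the
function on the unit circle. -/
theorem norm_sum_range_partialSum_taylorCoeffZero_le [CompleteSpace F]
    (hh : DifferentiableOn ℂ h (closedBall 0 1)) {c : ℝ}
    (hc : ∀ z ∈ sphere (0 : ℂ) 1, ‖h z‖ ≤ c) (m : ℕ) :
    ‖∑ l ∈ Finset.range m, ∑ k ∈ Finset.range (l + 1), taylorCoeffZero h k‖ ≤ m * c := by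
  have hker : Continuous fun θ => ‖∑ j ∈ Finset.range m, circleMap 0 1 θ ^ j‖ ^ 2 := by fun_prop
  have hone : ∫ θ in 0..2 * Real.pi, ‖∑ j ∈ Finset.range m, circleMap 0 1 θ ^ j‖ ^ 2 =
      2 * Real.pi * m := by
    have := integral_fejer_kernel_smul (h := fun _ : ℂ => (1 : ℂ)) (by fun_prop) m
    simp only [smul_eq_mul, mul_one, intervalIntegral.integral_ofReal] at this
    have hcoeff : ∀ k, taylorCoeffZero (fun _ : ℂ => (1 : ℂ)) k = if k = 0 then 1 else 0 := by
      intro k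
      rcases k with _ | k <;> simp [taylorCoeffZero, iteratedDeriv_const]
    simp only [hcoeff, Finset.sum_ite_eq', Finset.mem_range, Nat.succ_pos, if_true,
      Finset.sum_const, Finset.card_range, nsmul_eq_mul, mul_one] at this
    exact_mod_cast this
  have hbound : ‖(2 * Real.pi : ℂ) •
      ∑ l ∈ Finset.range m, ∑ k ∈ Finset.range (l + 1), taylorCoeffZero h k‖ ≤
      2 * Real.pi * m * c := by
    rw [← integral_fejer_kernel_smul hh m, ← hone, ← intervalIntegral.integral_mul_const]
    refine intervalIntegral.norm_integral_le_of_norm_le Real.two_pi_pos.le ?_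
      ((hker.mul continuous_const).intervalIntegrable _ _)
    refine Filter.Eventually.of_forall fun θ _ => ?_
    rw [norm_smul, norm_real, Real.norm_of_nonneg (by positivity)]
    gcongr
    exact hc _ (circleMap_mem_sphere 0 zero_le_one θ)
  rw [norm_smul] at hbound
  have h2 : ‖(2 * Real.pi : ℂ)‖ = 2 * Real.pi := by simp [abs_of_pos Real.pi_pos]
  rw [h2, mul_assoc _ (m : ℝ)] at hbound
  exact le_of_mul_le_mul_left hbound Real.two_pi_pos

end Cesaro

section CesaroMean

open Metric

variable {X Y : Type*} [NormedAddCommGroup X] [NormedSpace ℂ X]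
  [NormedAddCommGroup Y] [NormedSpace ℂ Y]

/-- The Cesàro mean of the first `m` partial sums of the Taylor series of `f` at `0`. -/
noncomputable def taylorCesaroMean (f : X → Y) (m : ℕ) (x : X) : Y :=
  (m : ℂ)⁻¹ • ∑ l ∈ Finset.range m, ∑ k ∈ Finset.range (l + 1),
    (k.factorial : ℂ)⁻¹ • iteratedFDeriv ℂ k f 0 fun _ => x

theorem isContPolyVanishingAtZero_taylorCesaroMean {f : X → Y} (hf0 : f 0 = 0) (m : ℕ) :
    IsContPolyVanishingAtZero (taylorCesaroMean f m) := by
  refine ⟨m, fun k => (m : ℂ)⁻¹ • ∑ l ∈ Finset.range m, if (k : ℕ) < l then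
    (((k : ℕ) + 1).factorial : ℂ)⁻¹ • iteratedFDeriv ℂ (k + 1) f 0 else 0, fun x => ?_⟩
  have hpartial : ∀ l ∈ Finset.range m, ∑ k ∈ Finset.range (l + 1),
      (k.factorial : ℂ)⁻¹ • (iteratedFDeriv ℂ k f 0 fun _ => x) =
      ∑ k ∈ Finset.range m, if k < l then
        ((k + 1).factorial : ℂ)⁻¹ • (iteratedFDeriv ℂ (k + 1) f 0 fun _ => x) else 0 := by
    intro l hl
    rw [Finset.sum_range_succ', iteratedFDeriv_zero_apply, hf0, smul_zero, add_zero,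
      ← Finset.sum_filter]
    refine Finset.sum_congr ?_ fun _ _ => rfl
    ext k
    have := Finset.mem_range.1 hl
    simp only [Finset.mem_filter, Finset.mem_range]
    omega
  rw [taylorCesaroMean, Finset.sum_congr rfl hpartial, Finset.sum_comm,
    ← Fin.sum_univ_eq_sum_range (fun k => ∑ l ∈ Finset.range m, if k < l then
      ((k + 1).factorial : ℂ)⁻¹ • (iteratedFDeriv ℂ (k + 1) f 0 fun _ => x) else 0),
    Finset.smul_sum]
  refine Finset.sum_congr rfl fun k _ => ?_
  rw [smul_apply, sum_apply]
  congr 1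
  refine Finset.sum_congr rfl fun l _ => ?_
  split_ifs <;> rfl

theorem exists_one_lt_forall_smul_mem_ball {x : X} (hx : x ∈ ball (0 : X) 1) :
    ∃ R > (1 : ℝ), ∀ z ∈ ball (0 : ℂ) R, z • x ∈ ball (0 : X) 1 := by
  have hx1 : ‖x‖ < 1 := by simpa using hx
  refine ⟨2 / (1 + ‖x‖), ?_, fun z hz => ?_⟩
  · rw [gt_iff_lt, lt_div_iff₀ (by positivity)]
    linarith
  · rw [mem_ball_zero_iff, lt_div_iff₀ (by positivity)] at hz
    rw [mem_ball_zero_iff, norm_smul]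
    nlinarith [norm_nonneg z, norm_nonneg x]

theorem smul_mem_ball_of_mem_closedBall {x : X} (hx : x ∈ ball (0 : X) 1) {z : ℂ}
    (hz : z ∈ closedBall (0 : ℂ) 1) : z • x ∈ ball (0 : X) 1 := by
  rw [mem_closedBall_zero_iff] at hz
  rw [mem_ball_zero_iff, norm_smul] at *
  exact (mul_le_of_le_one_left (norm_nonneg x) hz).trans_lt hx

variable [CompleteSpace Y] {f : X → Y}

theorem hasSum_inv_factorial_smul_iteratedFDeriv
    (hf : DifferentiableOn ℂ f (ball (0 : X) 1)) {x : X} (hx : x ∈ ball (0 : X) 1) :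
    HasSum (fun k : ℕ => (k.factorial : ℂ)⁻¹ • iteratedFDeriv ℂ k f 0 fun _ => x) (f x) := by
  obtain ⟨R, hR, hmem⟩ := exists_one_lt_forall_smul_mem_ball hx
  have hd : DifferentiableOn ℂ (fun z : ℂ => f (z • x)) (ball 0 R) :=
    hf.comp (by fun_prop) hmem
  have := Complex.hasSum_taylorSeries_on_ball hd (z := 1) (by simpa using hR)
  simpa [iteratedDeriv_comp_smul_right isOpen_ball hf x _ (z := 0) (by simp)] using this

theorem tendsto_taylorCesaroMean (hf : DifferentiableOn ℂ f (ball (0 : X) 1))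
    {x : X} (hx : x ∈ ball (0 : X) 1) :
    Filter.Tendsto (fun m => taylorCesaroMean f m x) Filter.atTop (nhds (f x)) := by
  have := ((hasSum_inv_factorial_smul_iteratedFDeriv hf hx).tendsto_sum_nat.comp
    (Filter.tendsto_add_atTop_nat 1)).cesaro_smul
  refine this.congr fun m => ?_
  rw [taylorCesaroMean, ← Complex.coe_smul]
  simp

theorem lipschitzOnWith_taylorCesaroMean (hf : DifferentiableOn ℂ f (ball (0 : X) 1))
    (hlip : LipschitzOnWith 1 f (ball (0 : X) 1)) (m : ℕ) :
    LipschitzOnWith 1 (taylorCesaroMean f m) (ball (0 : X) 1) := by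
  refine LipschitzOnWith.of_dist_le_mul fun x hx y hy => ?_
  have hmem : ∀ w ∈ ball (0 : X) 1, DifferentiableOn ℂ (fun z : ℂ => f (z • w))
      (closedBall 0 1) := fun w hw =>
    hf.comp (by fun_prop) fun z hz => smul_mem_ball_of_mem_closedBall hw hz
  have hanal : ∀ w ∈ ball (0 : X) 1, ∀ k : ℕ, ContDiffAt ℂ k (fun z : ℂ => f (z • w)) 0 :=
    fun w hw k => (((hmem w hw).mono ball_subset_closedBall).contDiffOn
      isOpen_ball).contDiffAt (ball_mem_nhds 0 zero_lt_one)
  have hcoeff : ∀ k, taylorCoeffZero (fun z : ℂ => f (z • x) - f (z • y)) k =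
      (k.factorial : ℂ)⁻¹ • (iteratedFDeriv ℂ k f 0 fun _ => x) -
        (k.factorial : ℂ)⁻¹ • (iteratedFDeriv ℂ k f 0 fun _ => y) := fun k => by
    rw [taylorCoeffZero, iteratedDeriv_fun_sub (hanal x hx k) (hanal y hy k),
      iteratedDeriv_comp_smul_right isOpen_ball hf x k (by simp),
      iteratedDeriv_comp_smul_right isOpen_ball hf y k (by simp), zero_smul, zero_smul, smul_sub]
  have key := norm_sum_range_partialSum_taylorCoeffZero_le ((hmem x hx).sub (hmem y hy))
    (c := ‖x - y‖) (fun z hz => by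
      have hz' := sphere_subset_closedBall hz
      have hz1 : ‖z‖ = 1 := by simpa using hz
      have := hlip.dist_le_mul _ (smul_mem_ball_of_mem_closedBall hx hz')
        _ (smul_mem_ball_of_mem_closedBall hy hz')
      rw [dist_eq_norm, dist_eq_norm, ← smul_sub, norm_smul, hz1] at this
      simpa using this) m
  have hsub : taylorCesaroMean f m x - taylorCesaroMean f m y = (m : ℂ)⁻¹ •
      ∑ l ∈ Finset.range m, ∑ k ∈ Finset.range (l + 1),
        taylorCoeffZero (fun z : ℂ => f (z • x) - f (z • y)) k := by
    simp only [hcoeff, Finset.sum_sub_distrib, smul_sub, taylorCesaroMean]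
  rw [dist_eq_norm, dist_eq_norm, hsub, norm_smul, norm_inv, Complex.norm_natCast]
  rcases Nat.eq_zero_or_pos m with rfl | hm
  · simp
  · rw [inv_mul_le_iff₀ (by positivity)]
    rw [NNReal.coe_one, one_mul]
    exact key

end CesaroMean

/-- Every holomorphic `1`-Lipschitz `f : B_X → Y` with `f 0 = 0` is the
pointwise limit on `B_X` of a sequence of continuous polynomials vanishing at `0`
that are `1`-Lipschitz on `B_X`. -/
theorem stmt_7 {X Y : Type*} [NormedAddCommGroup X] [NormedSpace ℂ X] [CompleteSpace X]
    [NormedAddCommGroup Y] [NormedSpace ℂ Y] [CompleteSpace Y]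
    (f : X → Y) (hf : DifferentiableOn ℂ f (Metric.ball (0 : X) 1))
    (hlip : LipschitzOnWith 1 f (Metric.ball (0 : X) 1)) (hf0 : f 0 = 0) :
    ∃ g : ℕ → X → Y,
      (∀ m, IsContPolyVanishingAtZero (g m) ∧
        LipschitzOnWith 1 (g m) (Metric.ball (0 : X) 1)) ∧
      ∀ x ∈ Metric.ball (0 : X) 1,
        Filter.Tendsto (fun m => g m x) Filter.atTop (nhds (f x)) := by
  exact ⟨taylorCesaroMean f, fun m => ⟨isContPolyVanishingAtZero_taylorCesaroMean hf0 m,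
    lipschitzOnWith_taylorCesaroMean hf hlip m⟩, fun x hx => tendsto_taylorCesaroMean hf hx⟩
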